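/- Let m > 0 and v > 0, and let μ = gaussianReal m v. Then (∫ y² dμ(y))·(∫ tanh(y) dμ(y)) − (∫ y dμ(y))·(∫ y·tanh(y) dμ(y)) = v·( ∫ tanh(y) dμ(y) − m·∫ (1 − tanh(y)²) dμ(y) ), and this quantity is strictly positive. -/

import Mathlib

open MeasureTheory ProbabilityTheory

namespace Real

theorem hasDerivAt_tanh (x : ℝ) : HasDerivAt tanh (1 - tanh x ^ 2) x := by
  have hc : cosh x ≠ 0 := (cosh_pos x).ne'
  have h := (hasDerivAt_sinh x).div (hasDerivAt_cosh x) hc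
  have he : tanh = sinh / cosh := funext tanh_eq_sinh_div_cosh
  rw [he]
  refine h.congr_deriv ?_
  rw [Pi.div_apply]
  field_simp

theorem continuous_tanh : Continuous tanh :=
  continuous_iff_continuousAt.2 fun x ↦ (hasDerivAt_tanh x).continuousAt

theorem strictConcaveOn_tanh : StrictConcaveOn ℝ (Set.Ici 0) tanh := by
  have hmono : StrictMono tanh := strictMono_of_deriv_pos fun x ↦ by
    rw [(hasDerivAt_tanh x).deriv]
    linarith [tanh_sq_lt_one x]
  refine StrictAntiOn.strictConcaveOn_of_deriv (convex_Ici 0) continuous_tanh.continuousOn ?_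
  intro x hx y hy hxy
  rw [interior_Ici, Set.mem_Ioi] at hx
  rw [(hasDerivAt_tanh x).deriv, (hasDerivAt_tanh y).deriv]
  have h0 := hmono hx
  rw [tanh_zero] at h0
  have := pow_lt_pow_left₀ (hmono hxy) h0.le two_ne_zero
  linarith

theorem mul_tanh_lt_mul_tanh {c x y : ℝ} (hc : 0 < c) (hx : 0 < x) (hxy : x < y) :
    x * tanh (c * y) < y * tanh (c * x) := by
  have hcx : 0 < c * x := mul_pos hc hx
  have hcxy : c * x < c * y := mul_lt_mul_of_pos_left hxy hc
  have h := strictConcaveOn_tanh.secant_strict_mono (a := 0) (x := c * x) (y := c * y)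
    Set.self_mem_Ici hcx.le (hcx.trans hcxy).le hcx.ne' (hcx.trans hcxy).ne' hcxy
  simp only [tanh_zero, sub_zero] at h
  rw [div_lt_div_iff₀ (hcx.trans hcxy) hcx] at h
  have : c * (x * tanh (c * y)) < c * (y * tanh (c * x)) := by linarith
  exact lt_of_mul_lt_mul_left this hc.le

theorem tanh_minor_mul_tanh_minor_nonneg {c d : ℝ} (hc : 0 < c) (hd : 0 < d) (x y : ℝ) :
    0 ≤ (x * tanh (c * y) - y * tanh (c * x)) * (x * tanh (d * y) - y * tanh (d * x)) := by
  wlog hx : 0 ≤ x generalizing x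
  · have := this (-x) (by linarith)
    simp only [mul_neg, tanh_neg] at this
    linarith
  wlog hy : 0 ≤ y generalizing y
  · have := this (-y) (by linarith)
    simp only [mul_neg, tanh_neg] at this
    linarith
  wlog hxy : x ≤ y generalizing x y
  · have := this y hy x hx (by linarith)
    linarith
  rcases hx.eq_or_lt with rfl | hx
  · simp
  rcases hxy.eq_or_lt with rfl | hxy
  · simp
  exact mul_nonneg_of_nonpos_of_nonpos (sub_nonpos.2 (mul_tanh_lt_mul_tanh hc hx hxy).le)
    (sub_nonpos.2 (mul_tanh_lt_mul_tanh hd hx hxy).le)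

end Real

namespace ProbabilityTheory

theorem integrable_id_gaussianReal (m : ℝ) (v : NNReal) :
    Integrable (fun y ↦ y) (gaussianReal m v) :=
  (memLp_id_gaussianReal 1).integrable le_rfl

theorem integrable_sq_gaussianReal (m : ℝ) (v : NNReal) :
    Integrable (fun y ↦ y ^ 2) (gaussianReal m v) :=
  (memLp_id_gaussianReal 2).integrable_sq

theorem _root_.MeasureTheory.Integrable.mul_tanh {μ : Measure ℝ} {f : ℝ → ℝ} (hf : Integrable f μ)
    (c : ℝ) : Integrable (fun y ↦ f y * Real.tanh (c * y)) μ := by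
  refine hf.mul_bdd (c := 1)
    (Real.continuous_tanh.comp (continuous_const_mul c)).aestronglyMeasurable
    (ae_of_all _ fun y ↦ ?_)
  exact (Real.abs_tanh_lt_one _).le

theorem integral_sq_gaussianReal (m : ℝ) (v : NNReal) :
    ∫ y, y ^ 2 ∂gaussianReal m v = m ^ 2 + v := by
  have h := variance_eq_sub (memLp_id_gaussianReal (μ := m) (v := v) 2)
  rw [variance_id_gaussianReal] at h
  simp [integral_id_gaussianReal] at h
  linarith

theorem integrable_gaussianReal_iff {m : ℝ} {v : NNReal} (hv : v ≠ 0) {f : ℝ → ℝ} :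
    Integrable f (gaussianReal m v) ↔ Integrable fun y ↦ gaussianPDFReal m v y * f y := by
  rw [gaussianReal_of_var_ne_zero _ hv, integrable_withDensity_iff_integrable_smul'
    (measurable_gaussianPDF m v) (ae_of_all _ fun _ ↦ gaussianPDF_lt_top)]
  simp [toReal_gaussianPDF]

theorem hasDerivAt_gaussianPDFReal (m : ℝ) {v : NNReal} (hv : v ≠ 0) (y : ℝ) :
    HasDerivAt (gaussianPDFReal m v) (-((y - m) / v) * gaussianPDFReal m v y) y := by
  have hv' : (v : ℝ) ≠ 0 := by exact_mod_cast hv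
  have h := ((((((hasDerivAt_id y).sub_const m).pow 2).neg).div_const (2 * (v : ℝ))).exp).const_mul
    (√(2 * Real.pi * v))⁻¹
  refine h.congr_deriv ?_
  simp [gaussianPDFReal]
  field_simp

/-- **Stein's identity** for a real Gaussian measure. -/
theorem integral_sub_mul_gaussianReal {m : ℝ} {v : NNReal} (hv : v ≠ 0) {f f' : ℝ → ℝ}
    (hderiv : ∀ y, HasDerivAt f (f' y) y) (hf : Integrable f (gaussianReal m v))
    (hf' : Integrable f' (gaussianReal m v))
    (hmul : Integrable (fun y ↦ (y - m) * f y) (gaussianReal m v)) :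
    ∫ y, (y - m) * f y ∂gaussianReal m v = v * ∫ y, f' y ∂gaussianReal m v := by
  have hv' : (v : ℝ) ≠ 0 := by exact_mod_cast hv
  have hint : Integrable (fun y ↦ f' y - (y - m) * f y / v) (gaussianReal m v) :=
    hf'.sub (hmul.div_const _)
  have h : ∫ y, gaussianPDFReal m v y * (f' y - (y - m) * f y / v) = 0 := by
    refine integral_eq_zero_of_hasDerivAt_of_integrable (fun y ↦ ?_)
      ((integrable_gaussianReal_iff hv).1 hint) ((integrable_gaussianReal_iff hv).1 hf)
    refine ((hasDerivAt_gaussianPDFReal m hv y).mul (hderiv y)).congr_deriv ?_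
    ring
  have h' := integral_gaussianReal_eq_integral_smul (μ := m) hv
    (f := fun y ↦ f' y - (y - m) * f y / v)
  simp only [smul_eq_mul] at h'
  rw [h, integral_sub hf' (hmul.div_const _), integral_div] at h'
  field_simp at h'
  linarith

/-- Under the Gaussian measure of mean `m` and variance `v`, the conditional expectation of the sign
of the coordinate given its absolute value `r` is `tanh (m / v * r)`. -/
theorem integral_mul_tanh_gaussianReal_of_odd (m : ℝ) {v : NNReal} (hv : v ≠ 0) {f : ℝ → ℝ}
    (hodd : ∀ y, f (-y) = -f y) (hf : Integrable f (gaussianReal m v)) :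
    ∫ y, f y * Real.tanh (m / v * y) ∂gaussianReal m v = ∫ y, f y ∂gaussianReal m v := by
  have hv' : (v : ℝ) ≠ 0 := by exact_mod_cast hv
  have heven (y : ℝ) : gaussianPDFReal m v (-y) * (1 - Real.tanh (m / v * -y)) =
      gaussianPDFReal m v y * (1 - Real.tanh (m / v * y)) := by
    have hpdf : gaussianPDFReal m v (-y) =
        gaussianPDFReal m v y * (Real.exp (-(m / v * y)) / Real.exp (m / v * y)) := by
      rw [gaussianPDFReal, gaussianPDFReal, mul_assoc (_)⁻¹, ← Real.exp_sub, ← Real.exp_add]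
      congr 2
      field_simp
      ring
    rw [hpdf, mul_neg, Real.tanh_neg, Real.tanh_eq]
    field_simp
    ring
  have h : ∫ y, gaussianPDFReal m v y * (f y - f y * Real.tanh (m / v * y)) = 0 := by
    have hneg := integral_neg_eq_self
      (fun y ↦ gaussianPDFReal m v y * (f y - f y * Real.tanh (m / v * y))) volume
    have hpt (y : ℝ) : gaussianPDFReal m v (-y) * (f (-y) - f (-y) * Real.tanh (m / v * -y)) =
        -(gaussianPDFReal m v y * (f y - f y * Real.tanh (m / v * y))) := by
      rw [hodd]
      linear_combination -f y * heven y
    simp only [hpt, integral_neg] at hneg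
    linarith
  have h' := integral_gaussianReal_eq_integral_smul (μ := m) hv
    (f := fun y ↦ f y - f y * Real.tanh (m / v * y))
  simp only [smul_eq_mul] at h'
  rw [h, integral_sub hf (hf.mul_tanh _)] at h'
  linarith

theorem isOpenPosMeasure_gaussianReal (m : ℝ) {v : NNReal} (hv : v ≠ 0) :
    (gaussianReal m v).IsOpenPosMeasure :=
  (gaussianReal_absolutelyContinuous' m hv).isOpenPosMeasure

/-- A strict Chebyshev correlation inequality for `y ↦ tanh (c * y) / y` and `y ↦ tanh (d * y) / y`
with respect to the weight `y ^ 2`. -/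
theorem integral_mul_tanh_mul_integral_mul_tanh_lt (m : ℝ) {v : NNReal} (hv : v ≠ 0) {c d : ℝ}
    (hc : 0 < c) (hd : 0 < d) :
    (∫ y, y * Real.tanh (c * y) ∂gaussianReal m v) *
        (∫ y, y * Real.tanh (d * y) ∂gaussianReal m v) <
      (∫ y, y ^ 2 ∂gaussianReal m v) *
        ∫ y, Real.tanh (c * y) * Real.tanh (d * y) ∂gaussianReal m v := by
  have := isOpenPosMeasure_gaussianReal m hv
  have h1 := integrable_id_gaussianReal m v
  have h2 := integrable_sq_gaussianReal m v
  have hyc := h1.mul_tanh c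
  have hyd := h1.mul_tanh d
  have hcd : Integrable (fun y ↦ Real.tanh (c * y) * Real.tanh (d * y)) (gaussianReal m v) := by
    simpa using ((integrable_const (1 : ℝ)).mul_tanh c).mul_tanh d
  have hcont (e : ℝ) : Continuous fun y ↦ Real.tanh (e * y) :=
    Real.continuous_tanh.comp (continuous_const_mul e)
  set A := ∫ y, Real.tanh (c * y) * Real.tanh (d * y) ∂gaussianReal m v
  set B := ∫ y, y * Real.tanh (c * y) ∂gaussianReal m v
  set C := ∫ y, y * Real.tanh (d * y) ∂gaussianReal m v
  set V := ∫ y, y ^ 2 ∂gaussianReal m v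
  let F (x y : ℝ) : ℝ :=
    (x * Real.tanh (c * y) - y * Real.tanh (c * x)) *
      (x * Real.tanh (d * y) - y * Real.tanh (d * x))
  have hF (x : ℝ) : F x = fun y ↦ x ^ 2 * (Real.tanh (c * y) * Real.tanh (d * y)) -
      x * Real.tanh (d * x) * (y * Real.tanh (c * y)) -
      x * Real.tanh (c * x) * (y * Real.tanh (d * y)) +
      Real.tanh (c * x) * Real.tanh (d * x) * y ^ 2 := by
    funext y
    simp only [F]
    ring
  have hFint (x : ℝ) : Integrable (F x) (gaussianReal m v) := by
    rw [hF]
    exact (((hcd.const_mul _).sub' (hyc.const_mul _)).sub' (hyd.const_mul _)).add (h2.const_mul _)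
  let G (x : ℝ) : ℝ := x ^ 2 * A - x * Real.tanh (d * x) * B - x * Real.tanh (c * x) * C +
    Real.tanh (c * x) * Real.tanh (d * x) * V
  have hG (x : ℝ) : ∫ y, F x y ∂gaussianReal m v = G x := by
    rw [hF, integral_add (((hcd.const_mul _).sub' (hyc.const_mul _)).sub' (hyd.const_mul _))
      (h2.const_mul _), integral_sub ((hcd.const_mul _).sub' (hyc.const_mul _)) (hyd.const_mul _),
      integral_sub (hcd.const_mul _) (hyc.const_mul _)]
    simp only [integral_const_mul, G, A, B, C, V]
  have hF_nonneg (x : ℝ) : 0 ≤ F x := Real.tanh_minor_mul_tanh_minor_nonneg hc hd x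
  have hF_cont (x : ℝ) : Continuous (F x) := by
    have := hcont c
    have := hcont d
    fun_prop
  have hG_pos : 0 < G 1 := by
    rw [← hG]
    refine integral_pos_of_integrable_nonneg_nonzero (hF_cont 1) (hFint 1) (hF_nonneg 1) (x := 2) ?_
    exact mul_ne_zero
      (sub_ne_zero.2 (Real.mul_tanh_lt_mul_tanh hc one_pos one_lt_two).ne)
      (sub_ne_zero.2 (Real.mul_tanh_lt_mul_tanh hd one_pos one_lt_two).ne)
  have hG_cont : Continuous G := by
    have := hcont c
    have := hcont d
    fun_prop
  have hGint : Integrable G (gaussianReal m v) :=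
    (((h2.mul_const _).sub' (hyd.mul_const _)).sub' (hyc.mul_const _)).add (hcd.mul_const _)
  have hpos : 0 < ∫ x, G x ∂gaussianReal m v :=
    integral_pos_of_integrable_nonneg_nonzero hG_cont hGint
      (fun x ↦ (hG x).symm ▸ integral_nonneg (hF_nonneg x)) hG_pos.ne'
  have heq : ∫ x, G x ∂gaussianReal m v = V * A - C * B - B * C + A * V := by
    simp only [G]
    rw [integral_add (((h2.mul_const _).sub' (hyd.mul_const _)).sub' (hyc.mul_const _))
      (hcd.mul_const _), integral_sub ((h2.mul_const _).sub' (hyd.mul_const _)) (hyc.mul_const _),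
      integral_sub (h2.mul_const _) (hyd.mul_const _)]
    simp only [integral_mul_const, A, B, C, V]
  linarith

end ProbabilityTheory

/-- For `μ = gaussianReal m v` with `m > 0` and `v > 0`,
`E[Y²]·E[tanh Y] − E[Y]·E[Y tanh Y] = v·(E[tanh Y] − m·E[1 − tanh²Y])`,
and this quantity is strictly positive. -/
theorem stmt11 (m : ℝ) (hm : 0 < m) (v : NNReal) (hv : 0 < v) :
    ((∫ y, y ^ 2 ∂(gaussianReal m v)) * (∫ y, Real.tanh y ∂(gaussianReal m v)) -
        (∫ y, y ∂(gaussianReal m v)) * (∫ y, y * Real.tanh y ∂(gaussianReal m v)) =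
      (v : ℝ) * ((∫ y, Real.tanh y ∂(gaussianReal m v)) -
        m * ∫ y, (1 - Real.tanh y ^ 2) ∂(gaussianReal m v))) ∧
    0 < (v : ℝ) * ((∫ y, Real.tanh y ∂(gaussianReal m v)) -
        m * ∫ y, (1 - Real.tanh y ^ 2) ∂(gaussianReal m v)) := by
  have hv0 : v ≠ 0 := hv.ne'
  have hvpos : (0 : ℝ) < v := by exact_mod_cast hv
  have h1 := integrable_id_gaussianReal m v
  have ht : Integrable Real.tanh (gaussianReal m v) := by
    simpa using (integrable_const (1 : ℝ)).mul_tanh 1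
  have hyt : Integrable (fun y ↦ y * Real.tanh y) (gaussianReal m v) := by
    simpa using h1.mul_tanh 1
  have ht2 : Integrable (fun y ↦ 1 - Real.tanh y ^ 2) (gaussianReal m v) := by
    simpa [sq] using (integrable_const (1 : ℝ)).sub' (ht.mul_tanh 1)
  have hstein := integral_sub_mul_gaussianReal hv0 Real.hasDerivAt_tanh ht ht2
    (by simpa only [sub_mul] using hyt.sub' (ht.const_mul m))
  simp only [sub_mul] at hstein
  rw [integral_sub hyt (ht.const_mul m), integral_const_mul] at hstein
  have hid := integral_id_gaussianReal (μ := m) (v := v)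
  have hsq := integral_sq_gaussianReal m v
  have heq : (∫ y, y ^ 2 ∂(gaussianReal m v)) * (∫ y, Real.tanh y ∂(gaussianReal m v)) -
        (∫ y, y ∂(gaussianReal m v)) * (∫ y, y * Real.tanh y ∂(gaussianReal m v)) =
      (v : ℝ) * ((∫ y, Real.tanh y ∂(gaussianReal m v)) -
        m * ∫ y, (1 - Real.tanh y ^ 2) ∂(gaussianReal m v)) := by
    rw [hid, hsq]
    linear_combination -m * hstein
  refine ⟨heq, ?_⟩
  have hodd1 := integral_mul_tanh_gaussianReal_of_odd m hv0 (f := fun y ↦ y) (fun _ ↦ rfl) h1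
  have hodd2 := integral_mul_tanh_gaussianReal_of_odd m hv0 Real.tanh_neg ht
  have hlt := integral_mul_tanh_mul_integral_mul_tanh_lt m hv0 one_pos (div_pos hm hvpos)
  simp only [one_mul, hodd1, hodd2] at hlt
  rw [← heq]
  linarith
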